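/- arXiv:2304.13020 — 3 statements merged into one kernel-verified Lean document; each statement's English description precedes it below -/
import Mathlib

section
/- Let n ≥ 2 and let d_1, ..., d_{n−1} be positive real numbers. Let M be the n×n real symmetric 'arrowhead' matrix with M_{1,1} = 0, M_{1,i+1} = M_{i+1,1} = d_i for 1 ≤ i ≤ n−1, M_{i+1,i+1} = −2 d_i for 1 ≤ i ≤ n−1, and all other entries 0. Then M has exactly 1 positive eigenvalue and n−1 negative eigenvalues. -/
open Matrix

/-- Number of positive eigenvalues (with multiplicity) of a real symmetric matrix. -/
noncomputable def posEig {n : ℕ} {A : Matrix (Fin n) (Fin n) ℝ} (hA : A.IsHermitian) : ℕ :=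
  Nat.card {i : Fin n // 0 < hA.eigenvalues i}

noncomputable def zeroEig {n : ℕ} {A : Matrix (Fin n) (Fin n) ℝ} (hA : A.IsHermitian) : ℕ :=
  Nat.card {i : Fin n // hA.eigenvalues i = 0}

noncomputable def negEig {n : ℕ} {A : Matrix (Fin n) (Fin n) ℝ} (hA : A.IsHermitian) : ℕ :=
  Nat.card {i : Fin n // hA.eigenvalues i < 0}

/-- Total weight of a walk: sum of weights of its edges. -/
noncomputable def walkWeight {V : Type*} {G : SimpleGraph V} (w : Sym2 V → ℝ)
    {u v : V} (p : G.Walk u v) : ℝ :=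
  (p.edges.map w).sum

/-- Weighted shortest-path distance. -/
noncomputable def wdist {V : Type*} (G : SimpleGraph V) (w : Sym2 V → ℝ) (u v : V) : ℝ :=
  sInf {x | ∃ p : G.Walk u v, walkWeight w p = x}

/-- The distance matrix of a weighted graph on `Fin n`. -/
noncomputable def distMatrix {n : ℕ} (G : SimpleGraph (Fin n)) (w : Sym2 (Fin n) → ℝ) :
    Matrix (Fin n) (Fin n) ℝ :=
  Matrix.of fun i j => wdist G w i j

/-- The action of an arrowhead matrix on a vector, away from the head coordinate. -/
theorem arrowhead_mulVec_succ {m : ℕ} {d : Fin (m + 1) → ℝ}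
    {M : Matrix (Fin (m + 2)) (Fin (m + 2)) ℝ}
    (hMcol : ∀ i : Fin (m + 1), M i.succ 0 = d i)
    (hMdiag : ∀ i : Fin (m + 1), M i.succ i.succ = -2 * d i)
    (hMoff : ∀ i j : Fin (m + 1), i ≠ j → M i.succ j.succ = 0)
    (v : Fin (m + 2) → ℝ) (i : Fin (m + 1)) :
    (M *ᵥ v) i.succ = d i * v 0 - 2 * d i * v i.succ := by
  rw [Matrix.mulVec, dotProduct, Fin.sum_univ_succ, hMcol,
    Finset.sum_eq_single i (fun j _ hj => by rw [hMoff i j hj.symm, zero_mul]) (by simp), hMdiag]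
  ring

/-- If every eigenvalue of a real symmetric matrix is negative, so is every diagonal entry. -/
theorem Matrix.IsHermitian.diag_neg_of_eigenvalues_neg {n : ℕ} {A : Matrix (Fin n) (Fin n) ℝ}
    (hA : A.IsHermitian) (h : ∀ k, hA.eigenvalues k < 0) (i : Fin n) : A i i < 0 := by
  set U := (hA.eigenvectorUnitary : Matrix (Fin n) (Fin n) ℝ) with hU
  have hUU : U * star U = 1 := Unitary.coe_mul_star_self _
  have hdiag : A i i = ∑ k, hA.eigenvalues k * U i k ^ 2 := by
    have hs := congrFun (congrFun hA.spectral_theorem i) i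
    rw [Unitary.conjStarAlgAut_apply, ← hU, Matrix.mul_apply] at hs
    rw [hs]
    refine Finset.sum_congr rfl fun k _ => ?_
    simp [Matrix.mul_diagonal, Matrix.star_apply]
    ring
  have hone : ∑ k, U i k ^ 2 = 1 := by
    have h1 := congrFun (congrFun hUU i) i
    simpa [Matrix.mul_apply, Matrix.star_apply, sq] using h1
  obtain ⟨k, -, hk⟩ : ∃ k ∈ Finset.univ, U i k ^ 2 ≠ 0 :=
    Finset.exists_ne_zero_of_sum_ne_zero (by rw [hone]; exact one_ne_zero)
  rw [hdiag]
  refine Finset.sum_neg' (fun j _ => mul_nonpos_of_nonpos_of_nonneg (h j).le (sq_nonneg _))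
    ⟨k, Finset.mem_univ k, mul_neg_of_neg_of_pos (h k) (lt_of_le_of_ne (sq_nonneg _) hk.symm)⟩

/-- The `n × n` arrowhead matrix (`n = m + 2 ≥ 2`) with zero `(1,1)` entry,
first row/column `d_1, …, d_{n-1}` (all positive), diagonal `-2 d_1, …, -2 d_{n-1}`, and
zeros elsewhere has exactly 1 positive and `n - 1` negative eigenvalues. -/
theorem arrowhead_inertia (m : ℕ) (d : Fin (m + 1) → ℝ) (hd : ∀ i, 0 < d i)
    (M : Matrix (Fin (m + 2)) (Fin (m + 2)) ℝ)
    (hM00 : M 0 0 = 0)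
    (hMrow : ∀ i : Fin (m + 1), M 0 i.succ = d i)
    (hMcol : ∀ i : Fin (m + 1), M i.succ 0 = d i)
    (hMdiag : ∀ i : Fin (m + 1), M i.succ i.succ = -2 * d i)
    (hMoff : ∀ i j : Fin (m + 1), i ≠ j → M i.succ j.succ = 0)
    (hM : M.IsHermitian) :
    posEig hM = 1 ∧ zeroEig hM = 0 ∧ negEig hM = m + 1 := by
  set ev := hM.eigenvalues with hev
  let b : Fin (m + 2) → Fin (m + 2) → ℝ := fun k => ⇑(hM.eigenvectorBasis k)
  have hb (k) : M *ᵥ b k = ev k • b k := hM.mulVec_eigenvectorBasis k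
  have hinner (k l) : ∑ i, b k i * b l i = if l = k then 1 else 0 := by
    have h := orthonormal_iff_ite.mp hM.eigenvectorBasis.orthonormal l k
    rw [PiLp.inner_apply] at h
    simpa [b] using h
  have htail (k) (hk : 0 ≤ ev k) (i : Fin (m + 1)) :
      b k i.succ = d i / (ev k + 2 * d i) * b k 0 := by
    have h := congrFun (hb k) i.succ
    rw [arrowhead_mulVec_succ hMcol hMdiag hMoff, Pi.smul_apply, smul_eq_mul] at h
    have := hd i
    rw [div_mul_eq_mul_div, eq_div_iff (by positivity)]
    linarith
  have hhead (k) (hk : 0 ≤ ev k) : b k 0 ≠ 0 := by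
    intro h0
    have h := hinner k k
    rw [Fin.sum_univ_succ] at h
    simp [htail k hk, h0] at h
  have huniq (k l) (hk : 0 ≤ ev k) (hl : 0 ≤ ev l) : l = k := by
    by_contra hne
    have h := hinner k l
    rw [if_neg hne, Fin.sum_univ_succ] at h
    have hfac : b k 0 * b l 0 *
        (1 + ∑ i, d i / (ev k + 2 * d i) * (d i / (ev l + 2 * d i))) = 0 := by
      rw [← h, mul_add, mul_one, Finset.mul_sum]
      congr 1
      refine Finset.sum_congr rfl fun i _ => ?_
      rw [htail k hk, htail l hl]
      ring
    have hpos : 0 < 1 + ∑ i, d i / (ev k + 2 * d i) * (d i / (ev l + 2 * d i)) := by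
      refine add_pos_of_pos_of_nonneg one_pos (Finset.sum_nonneg fun i _ => ?_)
      have := hd i
      positivity
    exact mul_ne_zero (mul_ne_zero (hhead k hk) (hhead l hl)) hpos.ne' hfac
  have hne (k) : ev k ≠ 0 := by
    intro hk
    have h := congrFun (hb k) 0
    rw [Matrix.mulVec, dotProduct, Fin.sum_univ_succ, hM00, Pi.smul_apply, hk, zero_smul,
      zero_mul, zero_add] at h
    refine (Finset.sum_pos (s := Finset.univ) (f := fun i => d i * (d i / (2 * d i)))
      (fun i _ => ?_) Finset.univ_nonempty).ne' ?_
    · have := hd i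
      positivity
    · refine (mul_eq_zero.mp ?_).resolve_right (hhead k hk.ge)
      rw [← h, Finset.sum_mul]
      refine Finset.sum_congr rfl fun i _ => ?_
      rw [hMrow, htail k hk.ge, hk, zero_add, mul_assoc]
  obtain ⟨k, hk⟩ : ∃ k, 0 < ev k := by
    by_contra! hall
    exact (hM.diag_neg_of_eigenvalues_neg (fun k => (hall k).lt_of_ne (hne k)) 0).ne hM00
  have hposiff (l) : 0 < ev l ↔ l = k :=
    ⟨fun hl => huniq k l hk.le hl.le, fun h => h ▸ hk⟩
  have hnegiff (l) : ev l < 0 ↔ l ≠ k := by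
    rw [Ne, ← hposiff, not_lt]
    exact ⟨le_of_lt, fun h => h.lt_of_ne (hne l)⟩
  refine ⟨?_, ?_, ?_⟩
  · simp only [posEig, ← hev, hposiff]
    simp
  · simp only [zeroEig, ← hev, hne]
    simp
  · simp only [negEig, ← hev, hnegiff]
    simp [Nat.card_eq_fintype_card, Fintype.card_subtype_compl]
end

section
/- Let G be a connected unweighted unicyclic graph on n = 2k+1+m vertices whose unique cycle has odd length 2k+1 (k ≥ 1, m ≥ 0). Then the distance matrix D(G) has inertia (n_+(D), n_0(D), n_-(D)) = (1, 0, 2k+m); that is, D(G) has exactly 1 positive eigenvalue, no zero eigenvalue, and 2k+m negative eigenvalues. -/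
open Matrix

/-- The distance from `0` to `t` in the cycle of length `2 * k + 1`. -/
def oddCycleNorm (k : ℕ) (t : ZMod (2 * k + 1)) : ℕ := min t.val (2 * k + 1 - t.val)

/-- The indicator function of `{1, …, k}` in `ZMod (2 * k + 1)`. -/
def arcIndicator (k : ℕ) (z : ZMod (2 * k + 1)) : ℝ := if 1 ≤ z.val ∧ z.val ≤ k then 1 else 0

/-- A bivariate function whose quadratic form is negative on nonzero vectors with zero sum. -/
def StrictCondNegDef {V : Type*} [Fintype V] (d : V → V → ℝ) : Prop :=
  ∀ x : V → ℝ, ∑ i, x i = 0 → x ≠ 0 → ∑ i, ∑ j, x i * x j * d i j < 0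

theorem ZMod.val_add_cases {n : ℕ} [NeZero n] (a b : ZMod n) :
    (a.val + b.val < n ∧ (a + b).val = a.val + b.val) ∨ (a + b).val + n = a.val + b.val := by
  rcases lt_or_ge (a.val + b.val) n with h | h
  · exact Or.inl ⟨h, ZMod.val_add_of_lt h⟩
  · exact Or.inr (ZMod.val_add_val_of_le h).symm

theorem ZMod.val_one_odd {k : ℕ} (hk : 1 ≤ k) : (1 : ZMod (2 * k + 1)).val = 1 := by
  rw [ZMod.val_one_eq_one_mod, Nat.mod_eq_of_lt (by omega)]

theorem ZMod.two_ne_zero_odd {k : ℕ} (hk : 1 ≤ k) : (2 : ZMod (2 * k + 1)) ≠ 0 := by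
  intro h
  have h1 := ZMod.val_add_cases (1 : ZMod (2 * k + 1)) 1
  rw [one_add_one_eq_two, h, ZMod.val_zero, ZMod.val_one_odd hk] at h1
  omega

theorem oddCycleNorm_add_one {k : ℕ} (hk : 1 ≤ k) (t : ZMod (2 * k + 1)) :
    oddCycleNorm k (t + 1) ≤ oddCycleNorm k t + 1 ∧
      oddCycleNorm k t ≤ oddCycleNorm k (t + 1) + 1 := by
  have h := ZMod.val_add_cases t 1
  rw [ZMod.val_one_odd hk] at h
  have h1 := ZMod.val_lt t
  have h2 := ZMod.val_lt (t + 1)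
  unfold oddCycleNorm
  omega

theorem card_arc_inter_translate (k : ℕ) (t : ZMod (2 * k + 1)) :
    (Finset.univ.filter fun z : ZMod (2 * k + 1) =>
      (1 ≤ z.val ∧ z.val ≤ k) ∧ (1 ≤ (z + t).val ∧ (z + t).val ≤ k)).card + oddCycleNorm k t
      = k := by
  have ht := ZMod.val_lt t
  obtain ⟨l, r, hr, hlr, hmem⟩ : ∃ l r : ℕ, r < 2 * k + 1 ∧ r + 1 - l + oddCycleNorm k t = k ∧
      ∀ z : ZMod (2 * k + 1), ((1 ≤ z.val ∧ z.val ≤ k) ∧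
        (1 ≤ (z + t).val ∧ (z + t).val ≤ k)) ↔ l ≤ z.val ∧ z.val ≤ r := by
    unfold oddCycleNorm
    rcases le_or_gt t.val k with h | h
    · refine ⟨1, k - t.val, by omega, by omega, fun z => ?_⟩
      have := ZMod.val_add_cases z t
      omega
    · refine ⟨2 * k + 1 - t.val + 1, k, by omega, by omega, fun z => ?_⟩
      have := ZMod.val_add_cases z t
      have := ZMod.val_lt (z + t)
      omega
  have hcard : (Finset.univ.filter fun z : ZMod (2 * k + 1) =>
      (1 ≤ z.val ∧ z.val ≤ k) ∧ (1 ≤ (z + t).val ∧ (z + t).val ≤ k)).card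
      = (Finset.Icc l r).card := by
    refine Finset.card_nbij' ZMod.val (fun m => (m : ZMod (2 * k + 1))) ?_ ?_ ?_ ?_
    · intro z hz
      simp only [Finset.coe_filter, Finset.mem_univ, true_and, Set.mem_ofPred_eq] at hz
      simpa using (hmem z).1 hz
    · intro m hm
      simp only [Finset.coe_Icc, Set.mem_Icc] at hm
      simp only [Finset.coe_filter, Finset.mem_univ, true_and, Set.mem_ofPred_eq]
      rwa [hmem, ZMod.val_natCast, Nat.mod_eq_of_lt (by omega)]
    · intro z _
      simp
    · intro m hm
      simp only [Finset.coe_Icc, Set.mem_Icc] at hm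
      simp only [ZMod.val_natCast]
      exact Nat.mod_eq_of_lt (by omega)
  rw [hcard, Nat.card_Icc]
  exact hlr

theorem sum_arcIndicator_mul (k : ℕ) (a b : ZMod (2 * k + 1)) :
    ∑ i, arcIndicator k (a - i) * arcIndicator k (b - i) = k - oddCycleNorm k (b - a) := by
  rw [← (Equiv.subLeft a).sum_comp]
  have h := card_arc_inter_translate k (b - a)
  rw [eq_sub_iff_add_eq]
  conv_rhs => rw [← h]
  push_cast
  congr 1
  rw [Finset.card_filter]
  push_cast
  refine Finset.sum_congr rfl fun z _ => ?_
  have h1 : a - (a - z) = z := by ring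
  have h2 : b - (a - z) = z + (b - a) := by ring
  simp only [Equiv.subLeft_apply, h1, h2, arcIndicator]
  split_ifs <;> simp_all

theorem sum_sq_arcIndicator (k : ℕ) (y : ZMod (2 * k + 1) → ℝ) :
    ∑ i, (∑ a, arcIndicator k (a - i) * y a) ^ 2
      = ∑ a, ∑ b, y a * y b * (k - oddCycleNorm k (b - a)) := by
  simp_rw [← sum_arcIndicator_mul, sq, Finset.sum_mul_sum, Finset.mul_sum]
  rw [Finset.sum_comm]
  refine Finset.sum_congr rfl fun a _ => ?_
  rw [Finset.sum_comm]
  refine Finset.sum_congr rfl fun b _ => Finset.sum_congr rfl fun i _ => ?_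
  ring

theorem arcIndicator_sub_arcIndicator {k : ℕ} (hk : 1 ≤ k) (z : ZMod (2 * k + 1)) :
    arcIndicator k z - arcIndicator k (z - 1)
      = (if z = 1 then 1 else 0) - (if z = (k : ZMod (2 * k + 1)) + 1 then 1 else 0) := by
  obtain ⟨w, rfl⟩ : ∃ w, z = w + 1 := ⟨z - 1, by ring⟩
  have h := ZMod.val_add_cases w 1
  rw [ZMod.val_one_odd hk] at h
  have h1 := ZMod.val_lt w
  have hk' : (k : ZMod (2 * k + 1)).val = k := by
    rw [ZMod.val_natCast, Nat.mod_eq_of_lt (by omega)]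
  have e1 : w + 1 = 1 ↔ w.val = 0 := by simp
  have e2 : w + 1 = (k : ZMod (2 * k + 1)) + 1 ↔ w.val = k := by
    rw [add_left_inj]
    constructor
    · rintro rfl
      exact hk'
    · intro h
      exact ZMod.val_injective _ (h.trans hk'.symm)
  simp only [arcIndicator, add_sub_cancel_right, e1, e2]
  split_ifs <;> first | omega | norm_num

theorem eq_zero_of_arc_sums_eq_zero {k : ℕ} (hk : 1 ≤ k) (y : ZMod (2 * k + 1) → ℝ)
    (hsum : ∑ a, y a = 0) (h : ∀ i, ∑ a, arcIndicator k (a - i) * y a = 0) : y = 0 := by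
  have hper : ∀ j, y (j + k) = y j := by
    intro j
    have h1 := h (j - 1)
    have h2 := h j
    have h3 : ∑ a, (arcIndicator k (a - (j - 1)) - arcIndicator k (a - (j - 1) - 1)) * y a = 0 := by
      have e : ∀ a : ZMod (2 * k + 1), a - (j - 1) - 1 = a - j := fun a => by ring
      simp only [e, sub_mul, Finset.sum_sub_distrib, h1, h2, sub_zero]
    simp only [arcIndicator_sub_arcIndicator hk] at h3
    have e1 : ∀ a : ZMod (2 * k + 1), a - (j - 1) = 1 ↔ a = j := fun a => by
      constructor
      · intro h; linear_combination h
      · rintro rfl; ring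
    have e2 : ∀ a : ZMod (2 * k + 1), a - (j - 1) = (k : ZMod (2 * k + 1)) + 1 ↔ a = j + k :=
      fun a => by
        constructor
        · intro h; linear_combination h
        · rintro rfl; ring
    simp only [e1, e2, sub_mul, ite_mul, one_mul, zero_mul, Finset.sum_sub_distrib,
      Finset.sum_ite_eq', Finset.mem_univ, if_true] at h3
    linarith
  have hn : (2 * k + 1 : ZMod (2 * k + 1)) = 0 := by
    exact_mod_cast ZMod.natCast_self (2 * k + 1)
  have hstep : ∀ j, y (j + 1) = y j := by
    intro j
    rw [← hper (j + 1), ← hper (j + 1 + k)]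
    congr 1
    linear_combination hn
  have hnat : ∀ m : ℕ, y m = y 0 := by
    intro m
    induction m with
    | zero => simp
    | succ m ih => rw [Nat.cast_succ, hstep, ih]
  have hconst : ∀ a, y a = y 0 := fun a => by
    rw [← hnat a.val, ZMod.natCast_zmod_val]
  have h0 : y 0 = 0 := by
    simp only [hconst, Finset.sum_const, Finset.card_univ, ZMod.card, nsmul_eq_mul] at hsum
    rcases mul_eq_zero.1 hsum with h | h
    · exact absurd h (by positivity)
    · exact h
  funext a
  rw [hconst, h0, Pi.zero_apply]

theorem strictCondNegDef_oddCycleNorm {k : ℕ} (hk : 1 ≤ k) :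
    StrictCondNegDef fun a b : ZMod (2 * k + 1) => (oddCycleNorm k (b - a) : ℝ) := by
  intro y hsum hy
  have hpos : 0 < ∑ i, (∑ a, arcIndicator k (a - i) * y a) ^ 2 := by
    refine lt_of_le_of_ne (Finset.sum_nonneg fun i _ => sq_nonneg _) fun h => hy ?_
    refine eq_zero_of_arc_sums_eq_zero hk y hsum fun i => ?_
    have := (Finset.sum_eq_zero_iff_of_nonneg fun i _ => sq_nonneg _).1 h.symm i
      (Finset.mem_univ i)
    exact pow_eq_zero_iff two_ne_zero |>.1 this
  rw [sum_sq_arcIndicator] at hpos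
  simp only [mul_sub, Finset.sum_sub_distrib] at hpos
  have h0 : ∑ a, ∑ b, y a * y b * (k : ℝ) = 0 := by
    simp_rw [← Finset.sum_mul, ← Finset.mul_sum, hsum]
    simp
  linarith

theorem SimpleGraph.Connected.le_dist_of_lipschitz {V : Type*} {G : SimpleGraph V}
    (hG : G.Connected) (f : V → ℕ) (hf : ∀ x y, G.Adj x y → f y ≤ f x + 1) (a b : V) :
    f b ≤ f a + G.dist a b := by
  have hwalk : ∀ {a b : V} (p : G.Walk a b), f b ≤ f a + p.length := by
    intro a b p
    induction p with
    | nil => simp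
    | cons h p ih =>
      have := hf _ _ h
      rw [SimpleGraph.Walk.length_cons]
      omega
  obtain ⟨p, hp⟩ := hG.exists_walk_length_eq_dist a b
  exact hp ▸ hwalk p

section PendantVertex

variable {V : Type*} {G : SimpleGraph V} {v u : V}

theorem SimpleGraph.Connected.dist_pendant (hG : G.Connected) (huv : G.Adj v u)
    (hu : ∀ w, G.Adj v w → w = u) {w : V} (hw : w ≠ v) : G.dist v w = G.dist u w + 1 := by
  classical
  apply le_antisymm
  · have := hG.dist_triangle (u := v) (v := u) (w := w)
    rw [SimpleGraph.dist_eq_one_iff_adj.2 huv] at this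
    omega
  · have := hG.le_dist_of_lipschitz (fun x => if x = v then 0 else G.dist u x + 1) (by
      intro x y hxy
      by_cases hy : y = v
      · simp [hy]
      · by_cases hx : x = v
        · subst hx
          rw [hu y hxy]
          simp [huv.ne']
        · simp only [hx, hy, if_false]
          have := hG.dist_triangle (u := u) (v := x) (w := y)
          rw [SimpleGraph.dist_eq_one_iff_adj.2 hxy] at this
          omega) v w
    simpa [hw] using this

theorem SimpleGraph.Connected.dist_induce_pendant (hG : G.Connected)
    (hG' : (G.induce {v}ᶜ).Connected) (huv : G.Adj v u)
    (hu : ∀ w, G.Adj v w → w = u) (a b : ({v}ᶜ : Set V)) :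
    (G.induce {v}ᶜ).dist a b = G.dist a b := by
  classical
  apply le_antisymm
  · let r : V → ({v}ᶜ : Set V) := fun x => if hx : x = v then ⟨u, huv.ne'⟩ else ⟨x, hx⟩
    have hr : ∀ c : ({v}ᶜ : Set V), r c = c := fun c => dif_neg c.2
    have := hG.le_dist_of_lipschitz (fun x => (G.induce {v}ᶜ).dist a (r x)) (by
      intro x y hxy
      have htri := hG'.dist_triangle (u := a) (v := r x) (w := r y)
      suffices h : (G.induce {v}ᶜ).dist (r x) (r y) ≤ 1 by omega
      by_cases hx : x = v
      · subst hx
        have hy := hu y hxy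
        subst hy
        simp [r, huv.ne']
      · by_cases hy : y = v
        · subst hy
          have hx' := hu x hxy.symm
          subst hx'
          simp [r, huv.ne']
        · refine (SimpleGraph.dist_eq_one_iff_adj.2 ?_).le
          simpa [r, hx, hy] using hxy) a b
    simpa [hr] using this
  · obtain ⟨p, hp⟩ := hG'.exists_walk_length_eq_dist a b
    rw [← hp, ← SimpleGraph.Walk.length_map (SimpleGraph.Embedding.induce ({v}ᶜ : Set V)).toHom p]
    exact SimpleGraph.dist_le _

theorem StrictCondNegDef.of_pendant [Fintype V] [Fintype ({v}ᶜ : Set V)] (hG : G.Connected)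
    (hG' : (G.induce {v}ᶜ).Connected) (huv : G.Adj v u) (hu : ∀ w, G.Adj v w → w = u)
    (h : StrictCondNegDef fun a b => ((G.induce {v}ᶜ).dist a b : ℝ)) :
    StrictCondNegDef fun a b => (G.dist a b : ℝ) := by
  classical
  intro x hsum hx
  set c := x v with hc
  let y : V → ℝ := fun w => if w = v then 0 else x w + if w = u then c else 0
  have hsub : ∀ f : V → ℝ, f v = 0 → ∑ w, f w = ∑ w : ({v}ᶜ : Set V), f w := by
    intro f hf
    rw [← Finset.sum_subtype (Finset.univ.erase v) (by simp) f]
    exact (Finset.sum_erase _ hf).symm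
  have hyv : y v = 0 := by simp [y]
  have hxy : ∀ w, x w = y w + c * ((if w = v then 1 else 0) - if w = u then 1 else 0) := by
    intro w
    by_cases h1 : w = v
    · subst h1
      simp [y, huv.ne, hc]
    · by_cases h2 : w = u <;> simp [y, h1, h2, huv.ne']
  have hysum : ∑ w, y w = 0 := by
    have : ∑ w, x w = ∑ w, y w := by
      rw [Finset.sum_congr rfl fun w _ => hxy w, Finset.sum_add_distrib, ← Finset.mul_sum,
        Finset.sum_sub_distrib]
      simp
    rw [← this, hsum]
  have hlin : ∑ j, y j * ((G.dist v j : ℝ) - G.dist u j) = 0 := by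
    rw [← hysum]
    refine Finset.sum_congr rfl fun j _ => ?_
    by_cases hj : j = v
    · rw [hj, hyv, zero_mul]
    · rw [hG.dist_pendant huv hu hj]
      push_cast
      ring
  have hduv : (G.dist u v : ℝ) = 1 := by
    exact_mod_cast SimpleGraph.dist_eq_one_iff_adj.2 huv.symm
  have hdvu : (G.dist v u : ℝ) = 1 := by
    exact_mod_cast SimpleGraph.dist_eq_one_iff_adj.2 huv
  have hquad : ∑ i, ∑ j, x i * x j * (G.dist i j : ℝ)
      = ∑ i, ∑ j, y i * y j * (G.dist i j : ℝ) - 2 * c ^ 2 := by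
    have hcol : ∀ f : V → ℝ, ∑ i, x i * f i = ∑ i, y i * f i + c * (f v - f u) := by
      intro f
      simp only [hxy, add_mul, Finset.sum_add_distrib, mul_assoc, sub_mul, ite_mul, one_mul,
        zero_mul, ← Finset.mul_sum, Finset.sum_sub_distrib, Finset.sum_ite_eq', Finset.mem_univ,
        if_true]
    have hlin' : ∑ i, y i * ((G.dist i v : ℝ) - G.dist i u) = 0 := by
      simpa only [SimpleGraph.dist_comm] using hlin
    simp only [mul_sub, Finset.sum_sub_distrib] at hlin
    simp only [mul_assoc, ← Finset.mul_sum, hcol]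
    simp only [mul_add, Finset.sum_add_distrib, mul_left_comm (y _) c, ← Finset.mul_sum, hlin',
      hduv, hdvu, SimpleGraph.dist_self]
    push_cast
    linear_combination c * hlin
  have hysub : ∑ i, ∑ j, y i * y j * (G.dist i j : ℝ)
      = ∑ i : ({v}ᶜ : Set V), ∑ j : ({v}ᶜ : Set V),
        y i * y j * ((G.induce {v}ᶜ).dist i j : ℝ) := by
    rw [hsub _ (by simp [hyv])]
    refine Finset.sum_congr rfl fun i _ => ?_
    rw [hsub _ (by simp [hyv])]
    refine Finset.sum_congr rfl fun j _ => ?_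
    rw [hG.dist_induce_pendant hG' huv hu]
  rw [hquad, hysub]
  by_cases hy : (fun w : ({v}ᶜ : Set V) => y w) = 0
  · have hy0 : ∀ w, y w = 0 := fun w => by
      by_cases hw : w = v
      · rw [hw, hyv]
      · exact congrFun hy ⟨w, hw⟩
    have hc0 : c ≠ 0 := by
      intro hc0
      apply hx
      funext w
      rw [hxy, hy0, hc0, Pi.zero_apply]
      ring
    simp only [hy0, zero_mul, Finset.sum_const_zero]
    have : 0 < c ^ 2 := by positivity
    linarith
  · have := h (fun w => y w) (by rw [← hsub y hyv, hysum]) hy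
    nlinarith [sq_nonneg c]

end PendantVertex

theorem SimpleGraph.Connected.dist_oddCycle {V : Type*} {G : SimpleGraph V} (hG : G.Connected)
    {k : ℕ} (hk : 1 ≤ k) (e : ZMod (2 * k + 1) ≃ V)
    (hadj : ∀ i w, G.Adj (e i) w ↔ w = e (i + 1) ∨ w = e (i - 1)) (a b : ZMod (2 * k + 1)) :
    G.dist (e a) (e b) = oddCycleNorm k (b - a) := by
  apply le_antisymm
  · have hle : ∀ (a : ZMod (2 * k + 1)) (t : ℕ), G.dist (e a) (e (a + t)) ≤ t := by
      intro a t
      induction t with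
      | zero => simp
      | succ t ih =>
        have h := hG.dist_triangle (u := e a) (v := e (a + t)) (w := e (a + (t + 1 : ℕ)))
        have h1 : G.Adj (e (a + t)) (e (a + (t + 1 : ℕ))) :=
          (hadj _ _).2 (Or.inl (by push_cast; rw [add_assoc]))
        rw [SimpleGraph.dist_eq_one_iff_adj.2 h1] at h
        omega
    have hle' : ∀ a b : ZMod (2 * k + 1), G.dist (e a) (e b) ≤ (b - a).val := by
      intro a b
      simpa using hle a (b - a).val
    have h1 := hle' a b
    have h2 := hle' b a
    rw [SimpleGraph.dist_comm] at h2
    have h := ZMod.val_add_cases (b - a) (a - b)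
    rw [sub_add_sub_cancel, sub_self, ZMod.val_zero] at h
    unfold oddCycleNorm
    omega
  · have := hG.le_dist_of_lipschitz (fun w => oddCycleNorm k (e.symm w - a)) (by
      intro x y hxy
      obtain ⟨i, rfl⟩ := e.surjective x
      rcases (hadj i y).1 hxy with rfl | rfl
      · simpa [add_sub_right_comm] using (oddCycleNorm_add_one hk (i - a)).1
      · have := (oddCycleNorm_add_one hk (i - 1 - a)).2
        rw [show i - 1 - a + 1 = i - a by ring] at this
        simpa using this) (e a) (e b)
    simpa [oddCycleNorm] using this

theorem strictCondNegDef_of_two_regular {V : Type*} [Fintype V] {G : SimpleGraph V}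
    [DecidableRel G.Adj] (hG : G.Connected) (hdeg : ∀ w, G.degree w = 2) {k : ℕ} (hk : 1 ≤ k)
    (c : ZMod (2 * k + 1) → V) (hinj : Function.Injective c) (hc : ∀ i, G.Adj (c i) (c (i + 1))) :
    StrictCondNegDef fun a b => (G.dist a b : ℝ) := by
  classical
  have hc' : ∀ i, G.Adj (c i) (c (i - 1)) := fun i => by
    simpa using (hc (i - 1)).symm
  have hadj : ∀ i w, G.Adj (c i) w ↔ w = c (i + 1) ∨ w = c (i - 1) := by
    intro i w
    have hne : c (i + 1) ≠ c (i - 1) := fun h =>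
      ZMod.two_ne_zero_odd hk (by linear_combination hinj h)
    have hsub : ({c (i + 1), c (i - 1)} : Finset V) ⊆ G.neighborFinset (c i) := by
      intro z hz
      rw [Finset.mem_insert, Finset.mem_singleton] at hz
      rcases hz with rfl | rfl
      · simpa using hc i
      · simpa using hc' i
    have heq := Finset.eq_of_subset_of_card_le hsub (by
      rw [SimpleGraph.card_neighborFinset_eq_degree, hdeg, Finset.card_pair hne])
    rw [← SimpleGraph.mem_neighborFinset, ← heq]
    simp
  have hsurj : Function.Surjective c := by
    intro w
    obtain ⟨p⟩ := hG.preconnected (c 0) w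
    have hwalk : ∀ {a b : V} (p : G.Walk a b), (∃ i, c i = a) → ∃ i, c i = b := by
      intro a b p
      induction p with
      | nil => exact id
      | cons h p ih =>
        rintro ⟨i, rfl⟩
        rcases (hadj i _).1 h with h | h
        · exact ih ⟨_, h.symm⟩
        · exact ih ⟨_, h.symm⟩
    exact hwalk p ⟨0, rfl⟩
  let e := Equiv.ofBijective c ⟨hinj, hsurj⟩
  intro x hsum hx
  have h := strictCondNegDef_oddCycleNorm hk (fun i => x (e i)) ((e.sum_comp x).trans hsum)
    (fun h0 => hx (funext fun w => by
      obtain ⟨i, rfl⟩ := e.surjective w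
      exact congrFun h0 i))
  simp only [← hG.dist_oddCycle hk e hadj] at h
  rw [← e.sum_comp]
  simp only [← e.sum_comp (fun j => x _ * x j * (G.dist _ j : ℝ))]
  exact h

theorem SimpleGraph.Connected.strictCondNegDef_dist {V : Type*} [Fintype V] {G : SimpleGraph V}
    (hG : G.Connected) (hcard : Nat.card G.edgeSet = Nat.card V) {k : ℕ} (hk : 1 ≤ k)
    (c : ZMod (2 * k + 1) → V) (hinj : Function.Injective c) (hc : ∀ i, G.Adj (c i) (c (i + 1))) :
    StrictCondNegDef fun a b => (G.dist a b : ℝ) := by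
  classical
  induction hN : Fintype.card V generalizing V with
  | zero =>
    have := Fintype.card_eq_zero_iff.1 hN
    exact this.elim (c 0)
  | succ N ih =>
    have hE : G.edgeFinset.card = Fintype.card V := by
      rw [← Nat.card_eq_fintype_card, ← hcard, Nat.card_eq_fintype_card,
        SimpleGraph.edgeFinset_card]
    have hpos : ∀ w, 0 < G.degree w := by
      have : Nontrivial V := ⟨c 0, c 1, by simpa using (hc 0).ne⟩
      exact fun w => hG.preconnected.degree_pos_of_nontrivial w
    by_cases hleaf : ∃ v, G.degree v = 1
    · obtain ⟨v, hv⟩ := hleaf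
      have hG' := hG.induce_compl_singleton_of_degree_eq_one hv
      obtain ⟨u, huv, hu⟩ := SimpleGraph.degree_eq_one_iff_existsUnique_adj.1 hv
      have hcv : ∀ i, c i ∈ ({v}ᶜ : Set V) := by
        rintro i rfl
        have h1 := hu _ (hc i)
        have h2 := hu (c (i - 1)) (by simpa using (hc (i - 1)).symm)
        have h3 := hinj (h1.trans h2.symm)
        exact ZMod.two_ne_zero_odd hk (by linear_combination h3)
      have hV' : Fintype.card ({v}ᶜ : Set V) = N := by
        rw [Fintype.card_compl_set, hN]
        simp
      refine StrictCondNegDef.of_pendant hG hG' huv hu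
        (ih hG' ?_ (fun i => ⟨c i, hcv i⟩) (fun i j h => hinj (congrArg Subtype.val h))
          (fun i => hc i) hV')
      rw [Nat.card_eq_fintype_card, Nat.card_eq_fintype_card, hV', ← SimpleGraph.edgeFinset_card]
      have h1 := G.card_edgeFinset_induce_compl_singleton v
      rw [SimpleGraph.card_edgeFinset_deleteIncidenceSet, hE, hN, hv, Nat.add_sub_cancel] at h1
      convert h1 using 1
    · push Not at hleaf
      have hge : ∀ w ∈ Finset.univ, 2 ≤ G.degree w := fun w _ => by
        have := hpos w
        have := hleaf w
        omega
      have hsum : ∑ _w : V, 2 = ∑ w, G.degree w := by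
        rw [SimpleGraph.sum_degrees_eq_twice_card_edges, hE]
        simp [mul_comm]
      have hdeg := (Finset.sum_eq_sum_iff_of_le hge).1 hsum
      exact strictCondNegDef_of_two_regular hG (fun w => (hdeg w (Finset.mem_univ w)).symm) hk c
        hinj hc

theorem SimpleGraph.Walk.IsCycle.exists_zmod_embedding {V : Type*} {G : SimpleGraph V} {u : V}
    {p : G.Walk u u} (hp : p.IsCycle) {n : ℕ} [NeZero n] (hlen : p.length = n) :
    ∃ c : ZMod n → V, Function.Injective c ∧ ∀ i, G.Adj (c i) (c (i + 1)) := by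
  have h3 := hp.three_le_length
  refine ⟨fun i => p.getVert i.val, fun i j hij => ?_, fun i => ?_⟩
  · have hi := ZMod.val_lt i
    have hj := ZMod.val_lt j
    refine ZMod.val_injective _ (hp.getVert_injOn' ?_ ?_ hij) <;>
      simp only [Set.mem_ofPred_eq] <;> omega
  · have hi := ZMod.val_lt i
    have h := p.adj_getVert_succ (i := i.val) (by omega)
    have hval := ZMod.val_add_cases i 1
    rw [ZMod.val_one_eq_one_mod, Nat.mod_eq_of_lt (by omega)] at hval
    rcases hval with ⟨_, hval⟩ | hval
    · rwa [← hval] at h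
    · have h0 : (i + 1).val = 0 := by omega
      have h1 : i.val + 1 = p.length := by omega
      rw [h1, SimpleGraph.Walk.getVert_length] at h
      simpa only [h0, SimpleGraph.Walk.getVert_zero] using h

theorem StrictCondNegDef.exists_pos_eigenvalue {n : ℕ} (hn : 2 ≤ n)
    {A : Matrix (Fin n) (Fin n) ℝ} (hA : A.IsHermitian) (htr : A.trace = 0)
    (h : StrictCondNegDef A) :
    ∃ i₀, 0 < hA.eigenvalues i₀ ∧ ∀ i, i ≠ i₀ → hA.eigenvalues i < 0 := by
  have hone : ∀ i j, i ≠ j → 0 ≤ hA.eigenvalues i → hA.eigenvalues j < 0 := by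
    intro i j hij hi
    by_contra! hj
    set v : Fin n → ℝ := ⇑(hA.eigenvectorBasis i)
    set w : Fin n → ℝ := ⇑(hA.eigenvectorBasis j)
    have horth := hA.eigenvectorBasis.orthonormal
    have hdot : ∀ a b, (⇑(hA.eigenvectorBasis a) : Fin n → ℝ) ⬝ᵥ ⇑(hA.eigenvectorBasis b)
        = if a = b then 1 else 0 := by
      intro a b
      have := (orthonormal_iff_ite.1 horth) b a
      rw [EuclideanSpace.inner_eq_star_dotProduct] at this
      simpa [eq_comm] using this
    have hvv : v ⬝ᵥ v = 1 := by simpa using hdot i i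
    have hww : w ⬝ᵥ w = 1 := by simpa using hdot j j
    have hvw : v ⬝ᵥ w = 0 := by simpa [hij] using hdot i j
    have hwv : w ⬝ᵥ v = 0 := by rw [dotProduct_comm, hvw]
    obtain ⟨a, b, hab, hsum⟩ : ∃ a b : ℝ, 0 < a ^ 2 + b ^ 2 ∧ a * ∑ l, v l + b * ∑ l, w l = 0 := by
      by_cases hs : ∑ l, v l = 0
      · exact ⟨1, 0, by norm_num, by simp [hs]⟩
      · refine ⟨∑ l, w l, -∑ l, v l, ?_, by ring⟩
        have : 0 < (∑ l, v l) ^ 2 := by positivity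
        rw [neg_sq]
        positivity
    have hAv : A *ᵥ v = hA.eigenvalues i • v := hA.mulVec_eigenvectorBasis i
    have hAw : A *ᵥ w = hA.eigenvalues j • w := hA.mulVec_eigenvectorBasis j
    have hne : a • v + b • w ≠ 0 := by
      intro h0
      have : (a • v + b • w) ⬝ᵥ (a • v + b • w) = a ^ 2 + b ^ 2 := by
        simp only [add_dotProduct, dotProduct_add, smul_dotProduct, dotProduct_smul, hvv, hww, hvw,
          hwv, smul_eq_mul]
        ring
      rw [h0, zero_dotProduct] at this
      linarith
    have hneg := h (a • v + b • w) (by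
      simpa [Finset.sum_add_distrib, Finset.mul_sum] using hsum) hne
    have hquad : ∑ l, ∑ m, (a • v + b • w) l * (a • v + b • w) m * A l m
        = (a • v + b • w) ⬝ᵥ (A *ᵥ (a • v + b • w)) := by
      simp only [dotProduct, mulVec, Finset.mul_sum]
      refine Finset.sum_congr rfl fun l _ => Finset.sum_congr rfl fun m _ => ?_
      ring
    rw [hquad, mulVec_add, mulVec_smul, mulVec_smul, hAv, hAw] at hneg
    simp only [add_dotProduct, dotProduct_add, smul_dotProduct, dotProduct_smul, hvv, hww, hvw,
      hwv, smul_eq_mul] at hneg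
    nlinarith [mul_nonneg (sq_nonneg a) hi, mul_nonneg (sq_nonneg b) hj]
  have hsum : ∑ i, hA.eigenvalues i = 0 := by
    have := hA.trace_eq_sum_eigenvalues
    rw [htr] at this
    simpa using this.symm
  obtain ⟨i₀, hi₀⟩ : ∃ i₀, 0 < hA.eigenvalues i₀ := by
    by_contra! hle
    have hz := (Finset.sum_eq_zero_iff_of_nonpos fun i _ => hle i).1 hsum
    have h1 := hone ⟨0, by omega⟩ ⟨1, by omega⟩ (by simp) (hz _ (Finset.mem_univ _)).ge
    exact h1.ne (hz _ (Finset.mem_univ _))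
  exact ⟨i₀, hi₀, fun i hi => hone i₀ i hi.symm hi₀.le⟩

theorem StrictCondNegDef.inertia {n : ℕ} (hn : 2 ≤ n)
    {A : Matrix (Fin n) (Fin n) ℝ} (hA : A.IsHermitian) (htr : A.trace = 0)
    (h : StrictCondNegDef A) : posEig hA = 1 ∧ zeroEig hA = 0 ∧ negEig hA = n - 1 := by
  obtain ⟨i₀, hpos, hneg⟩ := h.exists_pos_eigenvalue hn hA htr
  have e1 : ∀ i, 0 < hA.eigenvalues i ↔ i = i₀ := fun i =>
    ⟨fun hi => by_contra fun hne => (hneg i hne).not_gt hi, fun hi => hi ▸ hpos⟩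
  have e2 : ∀ i, ¬ hA.eigenvalues i = 0 := fun i hi => by
    by_cases hne : i = i₀
    · subst hne
      exact hpos.ne' hi
    · exact (hneg i hne).ne hi
  have e3 : ∀ i, hA.eigenvalues i < 0 ↔ i ≠ i₀ := fun i =>
    ⟨fun hi hne => hi.not_gt (hne ▸ hpos), hneg i⟩
  refine ⟨?_, ?_, ?_⟩
  · simp [posEig, e1]
  · simp [zeroEig, e2]
  · simp [negEig, e3]

/-- A connected unweighted unicyclic graph on `n = 2k + 1 + m` vertices
(`k ≥ 1`) whose unique cycle has odd length `2k + 1` has distance matrix of inertia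
`(1, 0, 2k + m)`. -/
theorem unicyclic_odd_cycle_inertia (k m : ℕ) (hk : 1 ≤ k)
    (G : SimpleGraph (Fin (2 * k + 1 + m)))
    (hconn : G.Connected) (huni : Nat.card G.edgeSet = 2 * k + 1 + m)
    (u : Fin (2 * k + 1 + m)) (p : G.Walk u u) (hp : p.IsCycle)
    (hlen : p.length = 2 * k + 1)
    (hD : (Matrix.of fun i j : Fin (2 * k + 1 + m) => (G.dist i j : ℝ)).IsHermitian) :
    posEig hD = 1 ∧ zeroEig hD = 0 ∧ negEig hD = 2 * k + m := by
  obtain ⟨c, hinj, hc⟩ := hp.exists_zmod_embedding hlen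
  have h := StrictCondNegDef.inertia (by omega) hD (by simp [Matrix.trace])
    (hconn.strictCondNegDef_dist (by rw [huni, Nat.card_fin]) hk c hinj hc)
  rwa [show 2 * k + 1 + m - 1 = 2 * k + m by omega] at h
end

section
/- Let G be a connected unweighted unicyclic graph on n = 2k+m vertices whose unique cycle has even length 2k (k ≥ 2, m ≥ 0). Then the distance matrix D(G) has inertia (n_+(D), n_0(D), n_-(D)) = (1, k−1, k+m); that is, D(G) has exactly 1 positive eigenvalue, the zero eigenvalue with multiplicity k−1, and k+m negative eigenvalues. -/
open Matrix

/-- A map `φ` of the vertices of `G` into a hypercube that sends edges to edges and does not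
decrease distances, such that every coordinate direction is used by some edge. -/
structure SimpleGraph.IsCubeEmbedding {V ι : Type*} [Fintype ι] (G : SimpleGraph V)
    (φ : V → ι → Bool) : Prop where
  hammingDist_of_adj : ∀ x y, G.Adj x y → hammingDist (φ x) (φ y) = 1
  dist_le : ∀ x y, G.dist x y ≤ hammingDist (φ x) (φ y)
  exists_adj_ne : ∀ c, ∃ x y, G.Adj x y ∧ φ x c ≠ φ y c

namespace SimpleGraph

open Finset

lemma hammingDist_le_length {V ι : Type*} [Fintype ι] {G : SimpleGraph V} {φ : V → ι → Bool}
    (h : ∀ x y, G.Adj x y → hammingDist (φ x) (φ y) = 1) {x y : V} (q : G.Walk x y) :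
    hammingDist (φ x) (φ y) ≤ q.length := by
  induction q with
  | nil => simp
  | @cons x y z hadj q ih =>
    have := hammingDist_triangle (φ x) (φ y) (φ z)
    rw [h _ _ hadj] at this
    rw [Walk.length_cons]
    lia

lemma IsCubeEmbedding.dist_eq {V ι : Type*} [Fintype ι] {G : SimpleGraph V} {φ : V → ι → Bool}
    (h : G.IsCubeEmbedding φ) (hconn : G.Connected) (x y : V) :
    G.dist x y = hammingDist (φ x) (φ y) := by
  obtain ⟨q, hq⟩ := hconn.exists_walk_length_eq_dist x y
  exact le_antisymm (h.dist_le x y) (hq ▸ hammingDist_le_length h.hammingDist_of_adj q)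

lemma hammingDist_option {ι : Type*} [Fintype ι] (a b : Bool) (f g : ι → Bool) :
    hammingDist (fun o : Option ι => o.elim a f) (fun o : Option ι => o.elim b g) =
      (if a ≠ b then 1 else 0) + hammingDist f g := by
  simp only [hammingDist, card_filter]
  rw [Fintype.sum_option]
  rfl

/-- A cube embedding extends over a pendant vertex, using one new coordinate. -/
lemma IsCubeEmbedding.exists_of_degree_eq_one {V ι : Type*} [Fintype V] [DecidableEq V] [Fintype ι]
    {G : SimpleGraph V} [DecidableRel G.Adj] (hconn : G.Connected) {v : V} (hv : G.degree v = 1)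
    {φ : ({v}ᶜ : Set V) → ι → Bool} (h : (G.induce {v}ᶜ).IsCubeEmbedding φ) :
    ∃ ψ : V → Option ι → Bool, G.IsCubeEmbedding ψ := by
  obtain ⟨w, hvw, hw⟩ := degree_eq_one_iff_existsUnique_adj.mp hv
  have hwv : w ≠ v := hvw.ne'
  have hconn' := hconn.induce_compl_singleton_of_degree_eq_one hv
  let r : V → ({v}ᶜ : Set V) := fun x => if hx : x = v then ⟨w, hwv⟩ else ⟨x, hx⟩
  have hrv : r v = ⟨w, hwv⟩ := by simp [r]
  have hr : ∀ x (hx : x ≠ v), r x = ⟨x, hx⟩ := fun x hx => by simp [r, hx]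
  let ψ : V → Option ι → Bool := fun x o => o.elim (decide (x = v)) (φ (r x))
  have hψ : ∀ x y, hammingDist (ψ x) (ψ y) =
      (if decide (x = v) ≠ decide (y = v) then 1 else 0) + hammingDist (φ (r x)) (φ (r y)) :=
    fun x y => hammingDist_option _ _ _ _
  have hdist : ∀ x y (hx : x ≠ v) (hy : y ≠ v),
      G.dist x y ≤ hammingDist (φ ⟨x, hx⟩) (φ ⟨y, hy⟩) := by
    intro x y hx hy
    obtain ⟨q, hq⟩ := hconn'.exists_walk_length_eq_dist ⟨x, hx⟩ ⟨y, hy⟩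
    refine le_trans ?_ (h.dist_le _ _)
    rw [← hq]
    exact (SimpleGraph.dist_le (q.map (Embedding.induce {v}ᶜ).toHom)).trans_eq
      (Walk.length_map _ _)
  have hdv : G.dist v w = 1 := dist_eq_one_iff_adj.mpr hvw
  have hdistv : ∀ y (hy : y ≠ v), G.dist v y ≤ 1 + hammingDist (φ ⟨w, hwv⟩) (φ ⟨y, hy⟩) := by
    intro y hy
    have := hconn.dist_triangle (u := v) (v := w) (w := y)
    have := hdist w y hwv hy
    lia
  refine ⟨ψ, ?_, ?_, ?_⟩
  · intro x y hxy
    rw [hψ]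
    by_cases hx : x = v
    · subst hx
      obtain rfl := hw y hxy
      simp [hrv, hr _ hwv, hwv]
    · by_cases hy : y = v
      · subst hy
        obtain rfl := hw x hxy.symm
        simp [hrv, hr _ hwv, hwv]
      · simpa [hx, hy, hr] using h.hammingDist_of_adj ⟨x, hx⟩ ⟨y, hy⟩ (by simpa using hxy)
  · intro x y
    rw [hψ]
    by_cases hx : x = v
    · subst hx
      by_cases hy : y = x
      · simp [hy]
      · simpa [hy, hr, hrv] using hdistv y hy
    · by_cases hy : y = v
      · subst hy
        rw [dist_comm, hammingDist_comm]
        simpa [hx, hr, hrv] using hdistv x hx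
      · simpa [hx, hy, hr] using hdist x y hx hy
  · rintro (_ | c)
    · exact ⟨v, w, hvw, by simp [ψ, hwv]⟩
    · obtain ⟨x, y, hxy, hc⟩ := h.exists_adj_ne c
      exact ⟨x, y, by simpa using hxy, by simpa [ψ, hr _ x.2, hr _ y.2] using hc⟩

/-- The cyclic sequence of vertices of the `k`-cube that gives an isometric `2 * k`-cycle. -/
def cubeCycle (k i : ℕ) (c : Fin k) : Bool := decide (c.1 < i ∧ i ≤ c.1 + k)

lemma cubeCycle_two_mul (k : ℕ) : cubeCycle k (2 * k) = cubeCycle k 0 := by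
  funext c
  simp [cubeCycle]
  lia

lemma hammingDist_cubeCycle {k i j : ℕ} (hij : i ≤ j) (hj : j ≤ 2 * k) :
    hammingDist (cubeCycle k i) (cubeCycle k j) = min (j - i) (2 * k - (j - i)) := by
  have key : hammingDist (cubeCycle k i) (cubeCycle k j) =
      #{c ∈ range k | ¬ ((c < i ∧ i ≤ c + k) ↔ (c < j ∧ j ≤ c + k))} := by
    rw [card_filter, sum_range, hammingDist, card_filter]
    refine sum_congr rfl fun c _ => ?_
    simp only [cubeCycle, ne_eq, decide_eq_decide]
  rw [key]
  have hsub : {c ∈ range k | ¬ ((c < i ∧ i ≤ c + k) ↔ (c < j ∧ j ≤ c + k))} =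
      if j ≤ k then Ico i j else if k ≤ i then Ico (i - k) (j - k)
        else if j - k ≤ i then range (j - k) ∪ Ico i k else range i ∪ Ico (j - k) k := by
    ext c
    split_ifs <;> simp <;> lia
  rw [hsub]
  split_ifs with h1 h2 h3
  · simp; lia
  · simp; lia
  · rw [card_union_of_disjoint (by rw [Finset.disjoint_left]; simp; lia)]
    simp; lia
  · rw [card_union_of_disjoint (by rw [Finset.disjoint_left]; simp; lia)]
    simp; lia

lemma Connected.dist_getVert_le {V : Type*} {G : SimpleGraph V} (hconn : G.Connected) {u v : V}
    (p : G.Walk u v) {i j : ℕ} (hij : i ≤ j) (hj : j ≤ p.length) :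
    G.dist (p.getVert i) (p.getVert j) ≤ j - i := by
  induction j, hij using Nat.le_induction with
  | base => simp
  | succ j hij ih =>
    have h1 := ih (by lia)
    have h2 := hconn.dist_triangle (u := p.getVert i) (v := p.getVert j) (w := p.getVert (j + 1))
    have h3 := dist_eq_one_iff_adj.mpr (p.adj_getVert_succ (i := j) (by lia))
    lia

/-- A connected graph all of whose vertices and edges lie on a `2 * k`-cycle embeds in the
`k`-cube. -/
lemma exists_isCubeEmbedding_cycle {V : Type*} {G : SimpleGraph V} (hconn : G.Connected) {k : ℕ}
    {u : V} {p : G.Walk u u} (hp : p.IsCycle) (hlen : p.length = 2 * k)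
    (hvert : ∀ x, x ∈ p.support) (hedge : ∀ e ∈ G.edgeSet, e ∈ p.edges) :
    ∃ φ : V → Fin k → Bool, G.IsCubeEmbedding φ := by
  have h3 := hp.three_le_length
  have hidx : ∀ x, ∃ i, i < 2 * k ∧ p.getVert i = x := by
    intro x
    obtain ⟨i, hi, hil⟩ := Walk.mem_support_iff_exists_getVert.mp (hvert x)
    rcases hil.lt_or_eq with h | h
    · exact ⟨i, by lia, hi⟩
    · exact ⟨0, by lia, by rw [← hi, h]; simp⟩
  choose f hf hfx using hidx
  have hfi : ∀ i < 2 * k, f (p.getVert i) = i := fun i hi =>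
    hp.getVert_injOn' (by have := hf (p.getVert i); simp; lia) (by simp; lia) (hfx _)
  have hφ : ∀ i ≤ 2 * k, cubeCycle k (f (p.getVert i)) = cubeCycle k i := by
    intro i hi
    rcases hi.lt_or_eq with h | rfl
    · rw [hfi i h]
    · have : p.getVert (2 * k) = p.getVert 0 := by rw [← hlen]; simp
      rw [this, hfi 0 (by lia), cubeCycle_two_mul]
  refine ⟨fun x => cubeCycle k (f x), ?_, ?_, ?_⟩
  · intro x y hxy
    have hstep : ∀ i < 2 * k, hammingDist (cubeCycle k (f (p.getVert i)))
        (cubeCycle k (f (p.getVert (i + 1)))) = 1 := by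
      intro i hi
      rw [hφ i hi.le, hφ (i + 1) hi, hammingDist_cubeCycle (by lia) hi]
      lia
    have hmem : p.toSubgraph.Adj x y := by
      rw [← Subgraph.mem_edgeSet, Walk.mem_edges_toSubgraph]
      exact hedge _ hxy
    obtain ⟨i, hi, hil⟩ := (Walk.toSubgraph_adj_iff p).mp hmem
    have := hstep i (by lia)
    rcases Sym2.eq_iff.mp hi with ⟨rfl, rfl⟩ | ⟨rfl, rfl⟩
    · exact this
    · rw [hammingDist_comm]; exact this
  · have hle : ∀ i j, i ≤ j → j ≤ 2 * k → G.dist (p.getVert i) (p.getVert j) ≤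
        hammingDist (cubeCycle k i) (cubeCycle k j) := by
      intro i j hij hj
      rw [hammingDist_cubeCycle hij hj]
      have h1 := hconn.dist_getVert_le p hij (by lia)
      have h2 := hconn.dist_getVert_le p (Nat.zero_le i) (by lia)
      have h3 := hconn.dist_getVert_le p (i := j) (j := p.length) (by lia) le_rfl
      have h4 := hconn.dist_triangle (u := p.getVert j) (v := u) (w := p.getVert i)
      rw [Walk.getVert_zero] at h2
      rw [Walk.getVert_length] at h3
      rw [dist_comm (u := p.getVert j) (v := p.getVert i)] at h4
      lia
    intro x y
    rcases le_total (f x) (f y) with h | h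
    · simpa [hfx] using hle _ _ h (hf y).le
    · rw [dist_comm, hammingDist_comm]
      simpa [hfx] using hle _ _ h (hf x).le
  · intro c
    refine ⟨p.getVert c, p.getVert (c + 1), p.adj_getVert_succ (by lia), ?_⟩
    simp only [hφ c (by lia), hφ (c + 1) (by lia)]
    simp [cubeCycle]
    lia

/-- In a connected graph with as many edges as vertices, a cycle missing some vertex forces a
vertex of degree one. -/
lemma Connected.exists_degree_eq_one {V : Type*} [Fintype V] [DecidableEq V] {G : SimpleGraph V}
    [DecidableRel G.Adj] (hconn : G.Connected) (hcard : #G.edgeFinset = Fintype.card V) {u : V}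
    {p : G.Walk u u} (hp : p.IsCycle) {x : V} (hx : x ∉ p.support) : ∃ v, G.degree v = 1 := by
  by_contra! hne
  have : Nontrivial V := ⟨x, u, fun h => hx (h ▸ p.start_mem_support)⟩
  have htwo : ∀ v ∈ univ, 2 ≤ G.degree v := by
    intro v _
    have := hne v
    have := hconn.preconnected.degree_pos_of_nontrivial v
    lia
  have hsum : ∑ v : V, 2 = ∑ v, G.degree v := by
    rw [sum_degrees_eq_twice_card_edges, hcard]
    simp [mul_comm]
  have hdeg := (sum_eq_sum_iff_of_le htwo).mp hsum
  obtain ⟨q⟩ := hconn.preconnected u x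
  obtain ⟨d, -, hd, hd'⟩ := q.exists_boundary_dart {v | v ∈ p.support} p.start_mem_support hx
  have hN := hp.ncard_neighborSet_toSubgraph_eq_two hd
  have hsub : p.toSubgraph.neighborSet d.fst ⊂ G.neighborSet d.fst := by
    refine ⟨p.toSubgraph.neighborSet_subset _, fun h => hd' ?_⟩
    have : d.snd ∈ p.toSubgraph.verts := (p.toSubgraph.edge_vert (h d.adj).symm)
    simpa using this
  have hlt := Set.ncard_lt_ncard hsub
  rw [hN, Set.ncard_eq_toFinset_card', Set.toFinset_card, card_neighborSet_eq_degree,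
    ← hdeg _ (mem_univ _)] at hlt
  exact hlt.false

/-- A connected unicyclic graph on `2 * k + m` vertices with a cycle of length `2 * k` embeds
isometrically in the `(k + m)`-cube. -/
theorem exists_isCubeEmbedding_of_unicyclic {k : ℕ} (m : ℕ) :
    ∀ {V : Type} [Fintype V] [DecidableEq V] (G : SimpleGraph V) [DecidableRel G.Adj],
      G.Connected → Fintype.card V = 2 * k + m → #G.edgeFinset = 2 * k + m →
      ∀ (u : V) (p : G.Walk u u), p.IsCycle → p.length = 2 * k →
      ∃ (ι : Type) (_ : Fintype ι) (φ : V → ι → Bool),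
        Fintype.card ι = k + m ∧ G.IsCubeEmbedding φ := by
  induction m with
  | zero =>
    intro V _ _ G _ hconn hV hE u p hp hlen
    have hvert : p.support.tail.toFinset = univ := by
      rw [← card_eq_iff_eq_univ, List.toFinset_card_of_nodup hp.support_nodup]
      simp [hV, hlen]
    have hedge : p.edges.toFinset = G.edgeFinset := by
      refine eq_of_subset_of_card_le (fun e he => ?_) ?_
      · simpa using p.edges_subset_edgeSet (by simpa using he)
      · rw [List.toFinset_card_of_nodup hp.edges_nodup]
        simp [hE, hlen]
    obtain ⟨φ, hφ⟩ := exists_isCubeEmbedding_cycle hconn hp hlen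
      (fun x => List.mem_of_mem_tail (List.mem_toFinset.mp (hvert ▸ mem_univ x)))
      (fun e he => List.mem_toFinset.mp (hedge ▸ mem_edgeFinset.mpr he))
    exact ⟨Fin k, inferInstance, φ, by simp, hφ⟩
  | succ m ih =>
    intro V _ _ G _ hconn hV hE u p hp hlen
    obtain ⟨x, hx⟩ : ∃ x, x ∉ p.support := by
      by_contra! hall
      have hle : #(univ : Finset V) ≤ #p.support.tail.toFinset := by
        refine card_le_card fun y _ => ?_
        rcases p.mem_support_iff.mp (hall y) with rfl | h
        · simpa using p.end_mem_tail_support hp.not_nil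
        · simpa using h
      have := List.toFinset_card_le p.support.tail
      rw [card_univ, hV] at hle
      simp [hlen] at this
      lia
    obtain ⟨v, hv⟩ := hconn.exists_degree_eq_one (hE.trans hV.symm) hp hx
    have hvp : v ∉ p.support := by
      intro h
      have h2 := hp.ncard_neighborSet_toSubgraph_eq_two h
      have hle := Set.ncard_le_ncard (p.toSubgraph.neighborSet_subset v)
      rw [h2, Set.ncard_eq_toFinset_card', Set.toFinset_card, card_neighborSet_eq_degree, hv]
        at hle
      lia
    have hp' : ∀ y ∈ p.support, y ∈ ({v}ᶜ : Set V) := fun y hy h => hvp (h ▸ hy)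
    have hmap := p.map_induce hp'
    obtain ⟨ι, _, φ, hι, hφ⟩ := ih (G.induce {v}ᶜ)
      (hconn.induce_compl_singleton_of_degree_eq_one hv)
      (by rw [Fintype.card_compl_set, hV, Fintype.card_unique]; lia)
      (by rw [card_edgeFinset_induce_compl_singleton, card_edgeFinset_deleteIncidenceSet, hE, hv]
          lia)
      _ (p.induce {v}ᶜ hp')
      ((Walk.isCycle_map_iff_of_injective (f := (Embedding.induce {v}ᶜ).toHom)
        (Embedding.induce (G := G) {v}ᶜ).injective).mp (hmap.symm ▸ hp))
      ((Walk.length_map _ _).symm.trans ((congrArg Walk.length hmap).trans hlen))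
    obtain ⟨ψ, hψ⟩ := hφ.exists_of_degree_eq_one hconn hv
    exact ⟨Option ι, inferInstance, ψ, by simp [hι]; lia, hψ⟩

end SimpleGraph

namespace SimpleGraph.IsCubeEmbedding

variable {n : ℕ} {ι : Type*} [Fintype ι] {G : SimpleGraph (Fin n)} {φ : Fin n → ι → Bool}

/-- The sign `1` or `-1` associated with a Boolean. -/
def boolSign (b : Bool) : ℝ := if b then 1 else -1

lemma two_mul_hammingDist (f g : ι → Bool) :
    2 * (hammingDist f g : ℝ) = Fintype.card ι - ∑ c, boolSign (f c) * boolSign (g c) := by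
  rw [hammingDist, Finset.card_filter]
  push_cast
  rw [← Finset.card_univ, Finset.card_eq_sum_ones, Finset.mul_sum]
  push_cast
  rw [← Finset.sum_sub_distrib]
  refine Finset.sum_congr rfl fun c _ => ?_
  cases f c <;> cases g c <;> norm_num [boolSign]

/-- Twice the distance matrix acting on a vector, in terms of the coordinates of the embedding. -/
lemma two_mul_dist_mulVec (h : G.IsCubeEmbedding φ) (hconn : G.Connected) (x : Fin n → ℝ)
    (i : Fin n) :
    2 * ((Matrix.of fun i j => (G.dist i j : ℝ)) *ᵥ x) i =
      Fintype.card ι * ∑ j, x j - ∑ c, boolSign (φ i c) * ∑ j, boolSign (φ j c) * x j := by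
  have : ∀ j, 2 * ((G.dist i j : ℝ) * x j) =
      Fintype.card ι * x j - ∑ c, boolSign (φ i c) * (boolSign (φ j c) * x j) := by
    intro j
    rw [← mul_assoc, h.dist_eq hconn, two_mul_hammingDist, sub_mul, Finset.sum_mul]
    simp only [mul_assoc]
  simp only [mulVec, dotProduct, Matrix.of_apply, Finset.mul_sum, this]
  rw [Finset.sum_sub_distrib, Finset.sum_comm]

/-- The constant function and the coordinates of a cube embedding are linearly independent. -/
lemma eq_zero_of_forall_eq_zero [Nonempty (Fin n)] (h : G.IsCubeEmbedding φ) {a : ℝ} {b : ι → ℝ}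
    (hab : ∀ x, a + ∑ c, b c * boolSign (φ x c) = 0) : a = 0 ∧ b = 0 := by
  have hb : b = 0 := by
    funext c
    obtain ⟨x, y, hxy, hc⟩ := h.exists_adj_ne c
    have hd := h.hammingDist_of_adj x y hxy
    obtain ⟨c', hc'⟩ := Finset.card_eq_one.mp hd
    have heq : ∀ d, d ≠ c → φ x d = φ y d := by
      intro d hdc
      by_contra hne
      have h1 : d ∈ ({c'} : Finset ι) := hc' ▸ by simpa using hne
      have h2 : c ∈ ({c'} : Finset ι) := hc' ▸ by simpa using hc
      rw [Finset.mem_singleton] at h1 h2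
      exact hdc (h1.trans h2.symm)
    have hsub : ∑ d, (b d * boolSign (φ x d) - b d * boolSign (φ y d)) = 0 := by
      rw [Finset.sum_sub_distrib]
      linarith [hab x, hab y]
    rw [Finset.sum_eq_single c (fun d _ hdc => by rw [heq d hdc, sub_self]) (by simp)] at hsub
    revert hc hsub
    cases φ x c <;> cases φ y c <;> simp [boolSign] <;> (intros; linarith)
  refine ⟨?_, hb⟩
  simpa [hb] using hab (Classical.arbitrary _)

/-- The matrix whose rows are the constant function and the coordinates of `φ`. -/
def signMatrix (φ : Fin n → ι → Bool) : Matrix (Option ι) (Fin n) ℝ :=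
  Matrix.of fun o x => o.elim 1 fun c => boolSign (φ x c)

lemma rank_signMatrix [Nonempty (Fin n)] (h : G.IsCubeEmbedding φ) :
    (signMatrix φ).rank = Fintype.card ι + 1 := by
  rw [LinearIndependent.rank_matrix, Fintype.card_option]
  rw [Fintype.linearIndependent_iff]
  intro g hg
  have := h.eq_zero_of_forall_eq_zero (a := g none) (b := fun c => g (some c)) fun x => by
    simpa [signMatrix, Matrix.row, Fintype.sum_option] using congrFun hg x
  rintro (_ | c)
  · exact this.1
  · exact congrFun this.2 c

lemma dist_mulVec_eq_zero_iff [Nonempty (Fin n)] [Nonempty ι] (h : G.IsCubeEmbedding φ)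
    (hconn : G.Connected) (x : Fin n → ℝ) :
    (Matrix.of fun i j => (G.dist i j : ℝ)) *ᵥ x = 0 ↔ signMatrix φ *ᵥ x = 0 := by
  have hsign : signMatrix φ *ᵥ x = 0 ↔ (∑ j, x j = 0) ∧ ∀ c, ∑ j, boolSign (φ j c) * x j = 0 := by
    rw [funext_iff, Option.forall]
    simp [signMatrix, mulVec, dotProduct]
  rw [hsign]
  constructor
  · intro h0
    have := h.eq_zero_of_forall_eq_zero (a := Fintype.card ι * ∑ j, x j)
      (b := fun c => -∑ j, boolSign (φ j c) * x j) fun i => by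
        have := h.two_mul_dist_mulVec hconn x i
        rw [h0, Pi.zero_apply, mul_zero] at this
        rw [this, sub_eq_add_neg, ← Finset.sum_neg_distrib]
        congr 1
        exact Finset.sum_congr rfl fun c _ => by ring
    refine ⟨?_, fun c => by simpa using congrFun this.2 c⟩
    simpa using this.1
  · rintro ⟨h1, h2⟩
    funext i
    have := h.two_mul_dist_mulVec hconn x i
    simpa [h1, h2] using this

lemma rank_dist [Nonempty (Fin n)] [Nonempty ι] (h : G.IsCubeEmbedding φ) (hconn : G.Connected) :
    (Matrix.of fun i j : Fin n => (G.dist i j : ℝ)).rank = Fintype.card ι + 1 := by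
  rw [← h.rank_signMatrix]
  have hker : (Matrix.of fun i j : Fin n => (G.dist i j : ℝ)).mulVecLin.ker =
      (signMatrix φ).mulVecLin.ker := by
    ext x
    simpa using h.dist_mulVec_eq_zero_iff hconn x
  have h1 := (Matrix.of fun i j : Fin n => (G.dist i j : ℝ)).mulVecLin.finrank_range_add_finrank_ker
  have h2 := (signMatrix φ).mulVecLin.finrank_range_add_finrank_ker
  rw [hker] at h1
  unfold Matrix.rank
  lia

lemma dotProduct_dist_mulVec_nonpos (h : G.IsCubeEmbedding φ) (hconn : G.Connected)
    {x : Fin n → ℝ} (hx : ∑ j, x j = 0) :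
    x ⬝ᵥ (Matrix.of fun i j => (G.dist i j : ℝ)) *ᵥ x ≤ 0 := by
  have h2 : 2 * (x ⬝ᵥ (Matrix.of fun i j => (G.dist i j : ℝ)) *ᵥ x) =
      -∑ c, (∑ j, boolSign (φ j c) * x j) ^ 2 := by
    simp only [dotProduct, Finset.mul_sum, mul_left_comm (2 : ℝ),
      h.two_mul_dist_mulVec hconn, hx, mul_zero, zero_sub, mul_neg, Finset.sum_neg_distrib]
    rw [Finset.sum_comm]
    congr 1
    refine Finset.sum_congr rfl fun c _ => ?_
    rw [sq, Finset.sum_mul]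
    refine Finset.sum_congr rfl fun i _ => ?_
    simp only [Finset.mul_sum]
    exact Finset.sum_congr rfl fun j _ => by ring
  have := Finset.sum_nonneg fun c (_ : c ∈ Finset.univ) =>
    sq_nonneg (∑ j, boolSign (φ j c) * x j)
  linarith

end SimpleGraph.IsCubeEmbedding

/-- A real symmetric matrix whose quadratic form is nonpositive on the vectors with coordinate sum
zero has at most one positive eigenvalue. -/
lemma posEig_le_one {n : ℕ} {A : Matrix (Fin n) (Fin n) ℝ} (hA : A.IsHermitian)
    (h : ∀ x : Fin n → ℝ, ∑ j, x j = 0 → x ⬝ᵥ A *ᵥ x ≤ 0) : posEig hA ≤ 1 := by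
  rw [posEig, Finite.card_le_one_iff_subsingleton]
  refine ⟨fun ⟨i, hi⟩ ⟨j, hj⟩ => ?_⟩
  by_contra hne
  have hij : i ≠ j := fun h => hne (Subtype.ext h)
  let v : Fin n → Fin n → ℝ := fun i => WithLp.ofLp (hA.eigenvectorBasis i)
  have hv : ∀ i, A *ᵥ v i = hA.eigenvalues i • v i := fun i => hA.mulVec_eigenvectorBasis i
  have hdot : ∀ i j, v i ⬝ᵥ v j = if i = j then 1 else 0 := by
    intro i j
    have := (orthonormal_iff_ite.mp hA.eigenvectorBasis.orthonormal) j i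
    rw [EuclideanSpace.inner_eq_star_dotProduct] at this
    simpa [v, eq_comm] using this
  have hform : ∀ a b : ℝ, (a • v i + b • v j) ⬝ᵥ A *ᵥ (a • v i + b • v j) =
      hA.eigenvalues i * a ^ 2 + hA.eigenvalues j * b ^ 2 := by
    intro a b
    simp only [mulVec_add, mulVec_smul, hv, add_dotProduct, dotProduct_add, smul_dotProduct,
      dotProduct_smul, hdot, hij, hij.symm, if_true, if_false, smul_eq_mul]
    ring
  obtain ⟨a, b, hab, hsum⟩ : ∃ a b : ℝ, (a ≠ 0 ∨ b ≠ 0) ∧ a * ∑ l, v i l + b * ∑ l, v j l = 0 := by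
    by_cases h0 : ∑ l, v i l = 0
    · exact ⟨1, 0, by simp, by simp [h0]⟩
    · exact ⟨∑ l, v j l, -∑ l, v i l, by simp [h0], by ring⟩
  have hle := h (a • v i + b • v j) (by
    simpa [Finset.sum_add_distrib, ← Finset.mul_sum] using hsum)
  rw [hform] at hle
  rcases hab with ha | hb
  · have := mul_pos hi (sq_pos_of_ne_zero ha)
    have := mul_nonneg hj.le (sq_nonneg b)
    linarith
  · have := mul_pos hj (sq_pos_of_ne_zero hb)
    have := mul_nonneg hi.le (sq_nonneg a)
    linarith

lemma posEig_add_zeroEig_add_negEig {n : ℕ} {A : Matrix (Fin n) (Fin n) ℝ} (hA : A.IsHermitian) :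
    posEig hA + zeroEig hA + negEig hA = n := by
  classical
  simp only [posEig, zeroEig, negEig, Nat.card_eq_fintype_card, Fintype.card_subtype,
    Finset.card_filter, ← Finset.sum_add_distrib]
  refine (Finset.sum_congr rfl fun i _ => ?_).trans (Fin.sum_const n 1 |>.trans (by simp))
  rcases lt_trichotomy (hA.eigenvalues i) 0 with h | h | h
  · simp [h, h.ne, h.not_gt]
  · simp [h]
  · simp [h, h.ne', h.not_gt]

lemma rank_add_zeroEig {n : ℕ} {A : Matrix (Fin n) (Fin n) ℝ} (hA : A.IsHermitian) :
    A.rank + zeroEig hA = n := by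
  classical
  rw [hA.rank_eq_card_non_zero_eigs, zeroEig, Nat.card_eq_fintype_card, add_comm,
    Fintype.card_subtype_compl]
  have := Fintype.card_subtype_le fun i => hA.eigenvalues i = 0
  rw [Fintype.card_fin] at this ⊢
  lia

lemma zeroEig_eq_of_trace_eq_zero_of_posEig_eq_zero {n : ℕ} {A : Matrix (Fin n) (Fin n) ℝ}
    (hA : A.IsHermitian) (htr : A.trace = 0) (hpos : posEig hA = 0) : zeroEig hA = n := by
  have hle : ∀ i, hA.eigenvalues i ≤ 0 := by
    intro i
    rw [posEig, Finite.card_eq_zero_iff] at hpos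
    by_contra! hi
    exact hpos.false ⟨i, hi⟩
  rw [hA.trace_eq_sum_eigenvalues] at htr
  have hall := (Finset.sum_eq_zero_iff_of_nonpos fun i _ => hle i).mp (by simpa using htr)
  simp at hall
  simp [zeroEig, hall]

/-- A connected unweighted unicyclic graph on `n = 2k + m` vertices
(`k ≥ 2`) whose unique cycle has even length `2k` has distance matrix of inertia
`(1, k - 1, k + m)`. -/
theorem unicyclic_even_cycle_inertia (k m : ℕ) (hk : 2 ≤ k)
    (G : SimpleGraph (Fin (2 * k + m)))
    (hconn : G.Connected) (huni : Nat.card G.edgeSet = 2 * k + m)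
    (u : Fin (2 * k + m)) (p : G.Walk u u) (hp : p.IsCycle)
    (hlen : p.length = 2 * k)
    (hD : (Matrix.of fun i j : Fin (2 * k + m) => (G.dist i j : ℝ)).IsHermitian) :
    posEig hD = 1 ∧ zeroEig hD = k - 1 ∧ negEig hD = k + m := by
  classical
  obtain ⟨ι, _, φ, hι, hφ⟩ := G.exists_isCubeEmbedding_of_unicyclic m hconn (by simp)
    (by rw [SimpleGraph.edgeFinset_card, ← Nat.card_eq_fintype_card, huni]) u p hp hlen
  have : Nonempty (Fin (2 * k + m)) := ⟨u⟩
  have : Nonempty ι := Fintype.card_pos_iff.mp (by lia)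
  have hle := posEig_le_one hD fun x hx => hφ.dotProduct_dist_mulVec_nonpos hconn hx
  have htotal := posEig_add_zeroEig_add_negEig hD
  have hrank := rank_add_zeroEig hD
  rw [hφ.rank_dist hconn, hι] at hrank
  have hpos : posEig hD ≠ 0 := fun h => by
    have := zeroEig_eq_of_trace_eq_zero_of_posEig_eq_zero hD (by simp [Matrix.trace]) h
    lia
  lia
end
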